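/- For every positive integer n and every positive integer r, the pair (exc_r, den_r) is r-Euler-Mahonian over S_n; that is, the joint distributions agree: for all nonnegative integers k and m, the number of permutations π in S_n with rdes(π) = k and rmaj(π) = m equals the number of permutations π in S_n with exc_r(π) = k and den_r(π) = m. Equivalently, ∑_{π∈S_n} t^{rdes(π)} q^{rmaj(π)} = ∑_{π∈S_n} t^{exc_r(π)} q^{den_r(π)}. -/

import Mathlib

open Finset

/-- The value of the permutation `π ∈ S_n` at the (1-based) position `i`,
in one-line notation with letters `1,…,n`; `0` if `i` is out of range. -/
def pval {n : ℕ} (π : Equiv.Perm (Fin n)) (i : ℕ) : ℕ :=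
  if h : 1 ≤ i ∧ i ≤ n then ((π ⟨i - 1, by omega⟩ : Fin n) : ℕ) + 1 else 0

/-- The number of inversions of a word `w`, i.e. pairs of positions `i < j`
with `w_i > w_j`. -/
def winv (w : List ℕ) : ℕ :=
  ((Finset.range w.length ×ˢ Finset.range w.length).filter
    (fun p => p.1 < p.2 ∧ w.getD p.2 0 < w.getD p.1 0)).card

/-- `rDes(π) = {i ∈ [n-1] : π_i ≥ π_{i+1} + r}`. -/
def rDesSet {n : ℕ} (r : ℕ) (π : Equiv.Perm (Fin n)) : Finset ℕ :=
  (Finset.Icc 1 (n - 1)).filter (fun i => pval π (i + 1) + r ≤ pval π i)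

/-- The `r`-descent number `rdes(π)`. -/
def rdes {n : ℕ} (r : ℕ) (π : Equiv.Perm (Fin n)) : ℕ := (rDesSet r π).card

/-- `rInv(π) = {(i,j) : i < j, π_i > π_j, π_i < π_j + r}`. -/
def rInvSet {n : ℕ} (r : ℕ) (π : Equiv.Perm (Fin n)) : Finset (ℕ × ℕ) :=
  ((Finset.Icc 1 n) ×ˢ (Finset.Icc 1 n)).filter
    (fun p => p.1 < p.2 ∧ pval π p.2 < pval π p.1 ∧ pval π p.1 < pval π p.2 + r)

/-- The `r`-major index `rmaj(π) = ∑_{i ∈ rDes(π)} i + |rInv(π)|`. -/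
def rmaj {n : ℕ} (r : ℕ) (π : Equiv.Perm (Fin n)) : ℕ :=
  (∑ i ∈ rDesSet r π, i) + (rInvSet r π).card

/-- The inversion number `inv(π)`: the number of pairs `i < j` with `π_i > π_j`. -/
def invStat {n : ℕ} (π : Equiv.Perm (Fin n)) : ℕ :=
  (((Finset.Icc 1 n) ×ˢ (Finset.Icc 1 n)).filter
    (fun p => p.1 < p.2 ∧ pval π p.2 < pval π p.1)).card

/-- `Excp_r(π)`: the set of `r`-level excedance places, i.e. indices `i`
with `π_i > i` and `π_i ≥ r`. -/
def excpSet {n : ℕ} (r : ℕ) (π : Equiv.Perm (Fin n)) : Finset ℕ :=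
  (Finset.Icc 1 n).filter (fun i => i < pval π i ∧ r ≤ pval π i)

/-- `Exc_r(π)`: the subword of `π` on the `r`-level excedance places,
in increasing order of position. -/
def excWord {n : ℕ} (r : ℕ) (π : Equiv.Perm (Fin n)) : List ℕ :=
  ((excpSet r π).sort (· ≤ ·)).map (pval π)

/-- `Nexc_r(π)`: the subword of `π` on the non-`r`-level-excedance places,
in increasing order of position. -/
def nexcWord {n : ℕ} (r : ℕ) (π : Equiv.Perm (Fin n)) : List ℕ :=
  (((Finset.Icc 1 n) \ excpSet r π).sort (· ≤ ·)).map (pval π)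

/-- The `r`-level Denert statistic
`den_r(π) = ∑_{i ∈ Excp_r(π)} i + inv(Exc_r(π)) + inv(Nexc_r(π))`. -/
def denr {n : ℕ} (r : ℕ) (π : Equiv.Perm (Fin n)) : ℕ :=
  (∑ i ∈ excpSet r π, i) + winv (excWord r π) + winv (nexcWord r π)

/-- The `r`-level excedance number `exc_r(π) = |{i : π_i > i ≥ r}|`. -/
def excr {n : ℕ} (r : ℕ) (π : Equiv.Perm (Fin n)) : ℕ :=
  ((Finset.Icc 1 n).filter (fun i => r ≤ i ∧ i < pval π i)).card

/-- The `q`-integer `[m]_q = 1 + q + ⋯ + q ^ (m - 1)`. -/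
def qNat {A : Type*} [CommRing A] (q : A) (m : ℕ) : A := ∑ i ∈ Finset.range m, q ^ i

/-- The shift of a sequence by one place to the right. -/
def shiftRight {A : Type*} [CommRing A] (f : ℕ → A) : ℕ → A
  | 0 => 0
  | h + 1 => f h

/-- One step of the weighted Motzkin path recursion for Denert's statistic, where `s` is the
weight of an excedance. -/
def motzkinStep {A : Type*} [CommRing A] (q s : A) (f : ℕ → A) (h : ℕ) : A :=
  (qNat q (h + 1) + s * qNat q h) * f h + s * shiftRight f h + qNat q (h + 1) ^ 2 * f (h + 1)

/-- The operator intertwining `motzkinStep q s` and `motzkinStep q (q * s)`. -/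
def intertwiner {A : Type*} [CommRing A] (q s : A) (f : ℕ → A) (h : ℕ) : A :=
  (1 - s * q ^ h) * f h + s * (1 - q) * shiftRight f h

/-- The composite of the steps with weights `s, s * q, …, s * q ^ (m - 1)`. -/
def motzkinIter {A : Type*} [CommRing A] (q s : A) (f : ℕ → A) : ℕ → ℕ → A
  | 0 => f
  | m + 1 => motzkinStep q (s * q ^ m) (motzkinIter q s f m)

section Motzkin

variable {A : Type*} [CommRing A] (q : A)

theorem qNat_zero : qNat q 0 = 0 := by simp [qNat]

theorem qNat_succ (m : ℕ) : qNat q (m + 1) = qNat q m + q ^ m := by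
  simp [qNat, Finset.sum_range_succ]

theorem one_sub_mul_qNat (m : ℕ) : (1 - q) * qNat q m = 1 - q ^ m :=
  mul_neg_geom_sum q m

theorem motzkinStep_intertwiner (s : A) (f : ℕ → A) :
    motzkinStep q (s * q) (intertwiner q s f) = intertwiner q (s * q) (motzkinStep q s f) := by
  funext h
  rcases h with _ | _ | h
  · simp only [motzkinStep, intertwiner, shiftRight, qNat_succ, qNat_zero]
    ring
  · simp only [motzkinStep, intertwiner, shiftRight, qNat_succ, qNat_zero]
    ring
  · have hq : q ^ h = 1 - (1 - q) * qNat q h := by rw [one_sub_mul_qNat]; ring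
    simp only [motzkinStep, intertwiner, shiftRight, qNat_succ, pow_succ, hq]
    ring

theorem motzkinIter_intertwiner (s : A) (f : ℕ → A) (m : ℕ) :
    motzkinIter q (s * q) (intertwiner q s f) m =
      intertwiner q (s * q ^ m) (motzkinIter q s f m) := by
  induction m with
  | zero => simp [motzkinIter]
  | succ m ih =>
    have h1 : s * q * q ^ m = s * q ^ m * q := by ring
    have h2 : s * q ^ (m + 1) = s * q ^ m * q := by ring
    rw [motzkinIter, ih, h1, motzkinStep_intertwiner, h2, motzkinIter]

theorem motzkinIter_succ' (s : A) (f : ℕ → A) (m : ℕ) :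
    motzkinIter q s f (m + 1) = motzkinIter q (s * q) (motzkinStep q s f) m := by
  induction m with
  | zero => simp [motzkinIter]
  | succ m ih =>
    rw [motzkinIter, ih, motzkinIter]
    congr 1
    ring

theorem motzkinIter_linear (s a b : A) (f g : ℕ → A) (m h : ℕ) :
    motzkinIter q s (fun j => a * f j + b * g j) m h =
      a * motzkinIter q s f m h + b * motzkinIter q s g m h := by
  induction m generalizing h with
  | zero => simp [motzkinIter]
  | succ m ih =>
    rcases h with _ | h <;> simp only [motzkinIter, motzkinStep, shiftRight, ih] <;> ring

/-- The initial sequences for which the path sums satisfy Rawlings' recursion. -/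
theorem motzkinIter_recursion (r : ℕ) (t : A) (g : ℕ → A)
    (hg : ∀ a, (1 - q) * qNat q (a + 1) ^ 2 * g (a + 1) = (q ^ (a + 1) - q ^ r) * g a) (m : ℕ) :
    (1 - q) * motzkinIter q (t * q ^ r) g (m + 1) 0 =
      (1 - t * q ^ (r + m)) * motzkinIter q (t * q ^ r) g m 0 -
        q ^ r * (1 - t) * motzkinIter q (t * q * q ^ r) g m 0 := by
  have key : intertwiner q (t * q ^ r) g =
      fun j => (1 - q) * motzkinStep q (t * q ^ r) g j + (q ^ r * (1 - t)) * g j := by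
    funext h
    rcases h with _ | h
    · have := hg 0
      have h0 : shiftRight g 0 = 0 := rfl
      simp only [intertwiner, motzkinStep, h0, qNat_succ, qNat_zero, zero_add, pow_zero] at this ⊢
      linear_combination -this
    · have h1 := hg (h + 1)
      have h2 := hg h
      have h3 := one_sub_mul_qNat q (h + 1)
      have h4 := one_sub_mul_qNat q (h + 1 + 1)
      have h0 : shiftRight g (h + 1) = g h := rfl
      simp only [intertwiner, motzkinStep, h0]
      linear_combination (-1 : A) * h1 - g (h + 1) * h4 - t * q ^ r * g (h + 1) * h3
  have h := congrFun (motzkinIter_intertwiner q (t * q ^ r) g m) 0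
  rw [key, motzkinIter_linear, ← motzkinIter_succ'] at h
  have h5 : t * q * q ^ r = t * q ^ r * q := by ring
  have h0 : shiftRight (motzkinIter q (t * q ^ r) g m) 0 = 0 := rfl
  rw [intertwiner, h0] at h
  rw [h5]
  linear_combination h

/-- The recursion satisfied by the contribution of the rows with index below the level. -/
theorem low_rows_ratio (c i : ℕ) (g g' : ℕ → A)
    (hg : ∀ a, (1 - q) * qNat q (a + 1) * qNat q (c + 1 + (a + 1)) * g (a + 1) =
      (q ^ (a + 1) - q ^ (i + 1)) * g a)
    (hg' : ∀ a, g' a = qNat q (c + 1 + a) * g a + q ^ (i + 1) * shiftRight g a) (a : ℕ) :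
    (1 - q) * qNat q (a + 1) * qNat q (c + (a + 1)) * g' (a + 1) =
      (q ^ (a + 1) - q ^ (i + 2)) * g' a := by
  have h1 := hg a
  have h2 := one_sub_mul_qNat q (a + 1)
  have h0 : shiftRight g (a + 1) = g a := rfl
  have hc : c + (a + 1) = c + 1 + a := by ring
  rw [hg' (a + 1), h0, hg' a, hc]
  rcases a with _ | a
  · have h3 : shiftRight g 0 = 0 := rfl
    rw [h3]
    linear_combination qNat q (c + 1 + 0) * h1 + qNat q (c + 1 + 0) * q ^ (i + 1) * g 0 * h2
  · have h3 : shiftRight g (a + 1) = g a := rfl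
    have h4 := hg a
    have h5 := one_sub_mul_qNat q (a + 1)
    rw [h3]
    linear_combination qNat q (c + 1 + (a + 1)) * h1 +
      qNat q (c + 1 + (a + 1)) * q ^ (i + 1) * g (a + 1) * h2 + q ^ (i + 2) * h4
      - q ^ (i + 2) * qNat q (c + 1 + (a + 1)) * g (a + 1) * h5

end Motzkin

theorem sum_pow_card_filter_gt {A : Type*} [CommRing A] (q : A) (s : Finset ℕ) :
    ∑ p ∈ s, q ^ (s.filter (fun o => p < o)).card = qNat q s.card := by
  induction s using Finset.induction_on_min with
  | empty => simp [qNat]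
  | insert a s ha ih =>
    have has : a ∉ s := fun h => lt_irrefl _ (ha a h)
    rw [Finset.sum_insert has, Finset.card_insert_of_notMem has, qNat_succ, ← ih, add_comm]
    congr 1
    · refine Finset.sum_congr rfl fun p hp => ?_
      rw [Finset.filter_insert, if_neg (by have := ha p hp; omega)]
    · rw [Finset.filter_insert, if_neg (lt_irrefl a), Finset.filter_true_of_mem ha]

theorem sum_pow_card_filter_lt {A : Type*} [CommRing A] (q : A) (s : Finset ℕ) :
    ∑ p ∈ s, q ^ (s.filter (fun o => o < p)).card = qNat q s.card := by
  induction s using Finset.induction_on_max with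
  | empty => simp [qNat]
  | insert a s ha ih =>
    have has : a ∉ s := fun h => lt_irrefl _ (ha a h)
    rw [Finset.sum_insert has, Finset.card_insert_of_notMem has, qNat_succ, ← ih, add_comm]
    congr 1
    · refine Finset.sum_congr rfl fun p hp => ?_
      rw [Finset.filter_insert, if_neg (by have := ha p hp; omega)]
    · rw [Finset.filter_insert, if_neg (lt_irrefl a), Finset.filter_true_of_mem ha]

section Pval

variable {n : ℕ} (π : Equiv.Perm (Fin n))

theorem pval_succ (i : Fin n) : pval π (i + 1) = π i + 1 := by
  simp [pval, i.2]

theorem pval_le (i : ℕ) : pval π i ≤ n := by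
  unfold pval
  split_ifs
  · exact (π _).2
  · exact Nat.zero_le n

theorem pval_pos {i : ℕ} (h1 : 1 ≤ i) (h2 : i ≤ n) : 1 ≤ pval π i := by
  simp [pval, h1, h2]

theorem pval_injOn {i j : ℕ} (hi : 1 ≤ i) (hi' : i ≤ n) (hj : 1 ≤ j) (hj' : j ≤ n)
    (h : pval π i = pval π j) : i = j := by
  obtain ⟨i, rfl⟩ : ∃ k, i = k + 1 := ⟨i - 1, by omega⟩
  obtain ⟨j, rfl⟩ : ∃ k, j = k + 1 := ⟨j - 1, by omega⟩
  have h1 := pval_succ π ⟨i, by omega⟩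
  have h2 := pval_succ π ⟨j, by omega⟩
  simp only at h1 h2
  rw [h1, h2] at h
  have := π.injective (Fin.ext (Nat.succ_injective h))
  simpa using this

theorem image_pval : (Finset.Icc 1 n).image (pval π) = Finset.Icc 1 n := by
  refine Finset.eq_of_subset_of_card_le ?_ ?_
  · intro v hv
    simp only [Finset.mem_image, Finset.mem_Icc] at hv ⊢
    obtain ⟨i, hi, rfl⟩ := hv
    exact ⟨pval_pos π hi.1 hi.2, pval_le π i⟩
  · rw [Finset.card_image_of_injOn]
    intro i hi j hj h
    simp only [Finset.coe_Icc, Set.mem_Icc] at hi hj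
    exact pval_injOn π hi.1 hi.2 hj.1 hj.2 h

theorem card_filter_pval (P : ℕ → Prop) [DecidablePred P] :
    ((Finset.Icc 1 n).filter (fun i => P (pval π i))).card =
      ((Finset.Icc 1 n).filter P).card := by
  conv_rhs => rw [← image_pval π, Finset.filter_image]
  rw [Finset.card_image_of_injOn]
  intro i hi j hj h
  simp only [Finset.coe_filter, Finset.mem_Icc, Set.mem_ofPred_eq] at hi hj
  exact pval_injOn π hi.1.1 hi.1.2 hj.1.1 hj.1.2 h

end Pval

section Insertion

variable {n : ℕ}

/-- The permutation obtained from `σ` by inserting the new largest letter after the first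
`p` letters. -/
def insertMax (p : Fin (n + 1)) (σ : Equiv.Perm (Fin n)) : Equiv.Perm (Fin (n + 1)) :=
  (finSuccEquiv' p).trans ((Equiv.optionCongr σ).trans (finSuccEquiv' (Fin.last n)).symm)

theorem insertMax_self (p : Fin (n + 1)) (σ : Equiv.Perm (Fin n)) :
    insertMax p σ p = Fin.last n := by
  simp [insertMax]

theorem insertMax_succAbove (p : Fin (n + 1)) (σ : Equiv.Perm (Fin n)) (i : Fin n) :
    insertMax p σ (p.succAbove i) = (σ i).castSucc := by
  simp [insertMax]

theorem insertMax_bijective :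
    Function.Bijective
      (fun x : Fin (n + 1) × Equiv.Perm (Fin n) => insertMax x.1 x.2) := by
  rw [Fintype.bijective_iff_injective_and_card]
  constructor
  · rintro ⟨p, σ⟩ ⟨p', σ'⟩ h
    simp only at h
    have hp : p = p' := by
      apply (insertMax p σ).injective
      rw [insertMax_self, h, insertMax_self]
    subst hp
    congr 1
    ext i
    have := congrArg (fun e => e (p.succAbove i)) h
    simp only [insertMax_succAbove] at this
    exact congrArg Fin.val (Fin.castSucc_injective n this)
  · simp [Fintype.card_perm, Nat.factorial_succ]

theorem pval_insertMax_of_le (p : Fin (n + 1)) (σ : Equiv.Perm (Fin n)) {i : ℕ}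
    (hi : i ≤ p) : pval (insertMax p σ) i = pval σ i := by
  rcases i with _ | i
  · simp [pval]
  · have hin : i < n := by omega
    have h := insertMax_succAbove p σ ⟨i, hin⟩
    rw [Fin.succAbove_of_castSucc_lt _ _ (by rw [Fin.lt_def]; simpa using hi)] at h
    have h1 := pval_succ (insertMax p σ) (Fin.castSucc ⟨i, hin⟩)
    have h2 := pval_succ σ ⟨i, hin⟩
    rw [h] at h1
    simpa [h2] using h1

theorem pval_insertMax_self (p : Fin (n + 1)) (σ : Equiv.Perm (Fin n)) :
    pval (insertMax p σ) (p + 1) = n + 1 := by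
  rw [pval_succ, insertMax_self]
  simp

theorem pval_insertMax_succ (p : Fin (n + 1)) (σ : Equiv.Perm (Fin n)) {i : ℕ}
    (hi : (p : ℕ) < i) : pval (insertMax p σ) (i + 1) = pval σ i := by
  obtain ⟨i, rfl⟩ : ∃ k, i = k + 1 := ⟨i - 1, by omega⟩
  by_cases hin : i < n
  · have h := insertMax_succAbove p σ ⟨i, hin⟩
    rw [Fin.succAbove_of_le_castSucc _ _ (by rw [Fin.le_def]; simp; omega)] at h
    have h1 := pval_succ (insertMax p σ) (Fin.succ ⟨i, hin⟩)
    have h2 := pval_succ σ ⟨i, hin⟩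
    rw [h] at h1
    simpa [h2] using h1
  · simp [pval, hin]

theorem mem_rDesSet {r : ℕ} {σ : Equiv.Perm (Fin n)} {i : ℕ} :
    i ∈ rDesSet r σ ↔ 1 ≤ i ∧ i < n ∧ pval σ (i + 1) + r ≤ pval σ i := by
  simp only [rDesSet, Finset.mem_filter, Finset.mem_Icc]
  constructor
  · rintro ⟨⟨h1, h2⟩, h3⟩
    exact ⟨h1, by omega, h3⟩
  · rintro ⟨h1, h2, h3⟩
    exact ⟨⟨h1, by omega⟩, h3⟩

theorem mem_rInvSet {r : ℕ} {σ : Equiv.Perm (Fin n)} {x : ℕ × ℕ} :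
    x ∈ rInvSet r σ ↔ 1 ≤ x.1 ∧ x.1 < x.2 ∧ x.2 ≤ n ∧
      pval σ x.2 < pval σ x.1 ∧ pval σ x.1 < pval σ x.2 + r := by
  simp only [rInvSet, Finset.mem_filter, Finset.mem_product, Finset.mem_Icc]
  constructor
  · rintro ⟨⟨⟨h1, h2⟩, h3, h4⟩, h5, h6, h7⟩
    exact ⟨h1, h5, h4, h6, h7⟩
  · rintro ⟨h1, h2, h3, h4, h5⟩
    exact ⟨⟨⟨h1, by omega⟩, by omega, h3⟩, h2, h4, h5⟩

/-- The slots of `σ` at which inserting the new largest letter creates no new `r`-descent. -/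
def neutralSlots (r : ℕ) (σ : Equiv.Perm (Fin n)) : Finset ℕ :=
  (Finset.range (n + 1)).filter
    (fun p => p = n ∨ p ∈ rDesSet r σ ∨ n + 1 < pval σ (p + 1) + r)

theorem rDesSet_insertMax {r : ℕ} (hr : 1 ≤ r) (p : Fin (n + 1)) (σ : Equiv.Perm (Fin n)) :
    rDesSet r (insertMax p σ) =
      (rDesSet r σ).image (fun d => if d < (p : ℕ) then d else d + 1) ∪
        (if (p : ℕ) ∈ neutralSlots r σ then ∅ else {(p : ℕ) + 1}) := by
  have hpn : (p : ℕ) ≤ n := by omega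
  have hself := pval_insertMax_self p σ
  ext i
  have himg : i ∈ (rDesSet r σ).image (fun d => if d < (p : ℕ) then d else d + 1) ↔
      (i < p ∧ i ∈ rDesSet r σ) ∨ ((p : ℕ) < i ∧ i - 1 ∈ rDesSet r σ) := by
    simp only [Finset.mem_image]
    constructor
    · rintro ⟨d, hd, rfl⟩
      split_ifs with h
      · exact Or.inl ⟨h, hd⟩
      · exact Or.inr ⟨by omega, by simpa using hd⟩
    · rintro (⟨h, hd⟩ | ⟨h, hd⟩)
      · exact ⟨i, hd, if_pos h⟩
      · exact ⟨i - 1, hd, by rw [if_neg (by omega)]; omega⟩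
  have hnew : i ∈ (if (p : ℕ) ∈ neutralSlots r σ then (∅ : Finset ℕ) else {(p : ℕ) + 1}) ↔
      i = p + 1 ∧ (p : ℕ) ∉ neutralSlots r σ := by
    split_ifs with h <;> simp [h]
  rw [Finset.mem_union, himg, hnew, mem_rDesSet]
  rcases lt_trichotomy i p with h | h | h
  · rw [pval_insertMax_of_le p σ (i := i + 1) (by omega), pval_insertMax_of_le p σ h.le,
      mem_rDesSet]
    omega
  · rw [h, hself]
    have := pval_le (insertMax p σ) p
    omega
  · by_cases h' : i = p + 1
    · subst h'
      rw [hself, pval_insertMax_succ p σ (by omega)]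
      simp only [neutralSlots, Finset.mem_filter, Finset.mem_range, mem_rDesSet,
        Nat.add_sub_cancel, true_and]
      have h1 := pval_le σ p
      by_cases hpn' : (p : ℕ) = n
      · omega
      · have h2 := pval_pos σ (i := p + 1) (by omega) (by omega)
        omega
    · obtain ⟨j, rfl⟩ : ∃ k, i = k + 1 := ⟨i - 1, by omega⟩
      rw [pval_insertMax_succ p σ (i := j + 1) (by omega),
        pval_insertMax_succ p σ (i := j) (by omega)]
      simp only [mem_rDesSet, Nat.add_sub_cancel]
      omega

theorem rInvSet_insertMax (r : ℕ) (p : Fin (n + 1)) (σ : Equiv.Perm (Fin n)) :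
    rInvSet r (insertMax p σ) =
      (rInvSet r σ).image (Prod.map (fun i => if i ≤ (p : ℕ) then i else i + 1)
          (fun i => if i ≤ (p : ℕ) then i else i + 1)) ∪
        ((Finset.Ioc (p : ℕ) n).filter (fun j => n + 1 < pval σ j + r)).image
          (fun j => ((p : ℕ) + 1, j + 1)) := by
  have hpn : (p : ℕ) ≤ n := by omega
  have hself := pval_insertMax_self p σ
  have hval : ∀ i, pval (insertMax p σ) (if i ≤ (p : ℕ) then i else i + 1) = pval σ i := by
    intro i
    split_ifs with h
    · exact pval_insertMax_of_le p σ h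
    · exact pval_insertMax_succ p σ (by omega)
  have hsurj : ∀ i, i ≠ (p : ℕ) + 1 → ∃ k, (if k ≤ (p : ℕ) then k else k + 1) = i := by
    intro i hi
    by_cases h : i ≤ p
    · exact ⟨i, if_pos h⟩
    · exact ⟨i - 1, by rw [if_neg (by omega)]; omega⟩
  ext ⟨i, j⟩
  simp only [Finset.mem_union, Finset.mem_image, Prod.map, Prod.exists, Prod.mk.injEq,
    Finset.mem_filter, Finset.mem_Ioc, mem_rInvSet]
  constructor
  · rintro ⟨h1, h2, h3, h4, h5⟩
    by_cases hj : j = p + 1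
    · subst hj
      have := pval_le (insertMax p σ) i
      omega
    · by_cases hi : i = p + 1
      · subst hi
        obtain ⟨j, rfl⟩ : ∃ k, j = k + 1 := ⟨j - 1, by omega⟩
        rw [hself, pval_insertMax_succ p σ (by omega)] at h5
        exact Or.inr ⟨j, ⟨⟨by omega, by omega⟩, h5⟩, rfl, rfl⟩
      · obtain ⟨i, rfl⟩ := hsurj i hi
        obtain ⟨j, rfl⟩ := hsurj j hj
        simp only [hval] at h4 h5
        refine Or.inl ⟨i, j, ⟨?_, ?_, ?_, h4, h5⟩, rfl, rfl⟩ <;> split_ifs at * <;> omega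
  · rintro (⟨i, j, ⟨h1, h2, h3, h4, h5⟩, rfl, rfl⟩ | ⟨j, ⟨⟨h1, h2⟩, h3⟩, rfl, rfl⟩)
    · simp only [hval]
      refine ⟨?_, ?_, ?_, h4, h5⟩ <;> split_ifs <;> omega
    · rw [hself, pval_insertMax_succ p σ (by omega)]
      have := pval_le σ j
      exact ⟨by omega, by omega, by omega, by omega, h3⟩

theorem rdes_insertMax {r : ℕ} (hr : 1 ≤ r) (p : Fin (n + 1)) (σ : Equiv.Perm (Fin n)) :
    rdes r (insertMax p σ) = rdes r σ + if (p : ℕ) ∈ neutralSlots r σ then 0 else 1 := by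
  rw [rdes, rDesSet_insertMax hr, Finset.card_union_of_disjoint, Finset.card_image_of_injective]
  · rw [rdes]
    split_ifs <;> simp
  · intro a b h
    simp only at h
    split_ifs at h <;> omega
  · split_ifs with h
    · simp
    · rw [Finset.disjoint_singleton_right, Finset.mem_image]
      rintro ⟨d, hd, h'⟩
      have : d = p := by split_ifs at h' <;> omega
      subst this
      exact h (Finset.mem_filter.2 ⟨Finset.mem_range.2 p.2, Or.inr (Or.inl hd)⟩)

theorem card_rInvSet_insertMax (r : ℕ) (p : Fin (n + 1)) (σ : Equiv.Perm (Fin n)) :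
    (rInvSet r (insertMax p σ)).card = (rInvSet r σ).card +
      ((Finset.Ioc (p : ℕ) n).filter (fun j => n + 1 < pval σ j + r)).card := by
  have hinj : Function.Injective (fun i : ℕ => if i ≤ (p : ℕ) then i else i + 1) := by
    intro a b h
    simp only at h
    split_ifs at h <;> omega
  rw [rInvSet_insertMax, Finset.card_union_of_disjoint,
    Finset.card_image_of_injective _ (hinj.prodMap hinj), Finset.card_image_of_injective]
  · intro a b h
    simpa using h
  · rw [Finset.disjoint_left]
    rintro x hx hx'
    simp only [Finset.mem_image] at hx hx'
    obtain ⟨⟨i, j⟩, _, rfl⟩ := hx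
    obtain ⟨k, _, hk⟩ := hx'
    have := congrArg Prod.fst hk
    simp only [Prod.map] at this
    split_ifs at this <;> omega

theorem sum_rDesSet_insertMax {r : ℕ} (hr : 1 ≤ r) (p : Fin (n + 1)) (σ : Equiv.Perm (Fin n)) :
    ∑ i ∈ rDesSet r (insertMax p σ), i =
      ∑ i ∈ rDesSet r σ, i + ((rDesSet r σ).filter (fun d => (p : ℕ) ≤ d)).card +
        if (p : ℕ) ∈ neutralSlots r σ then 0 else (p : ℕ) + 1 := by
  rw [rDesSet_insertMax hr, Finset.sum_union, Finset.sum_image, Finset.card_filter,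
    ← Finset.sum_add_distrib]
  · congr 1
    · refine Finset.sum_congr rfl fun d _ => ?_
      split_ifs <;> omega
    · split_ifs <;> simp
  · intro a _ b _ h
    simp only at h
    split_ifs at h <;> omega
  · split_ifs with h
    · simp
    · rw [Finset.disjoint_singleton_right, Finset.mem_image]
      rintro ⟨d, hd, h'⟩
      have : d = p := by split_ifs at h' <;> omega
      subst this
      exact h (Finset.mem_filter.2 ⟨Finset.mem_range.2 p.2, Or.inr (Or.inl hd)⟩)

theorem card_neutralSlots_ge {r : ℕ} (σ : Equiv.Perm (Fin n)) {p : ℕ} (hp : p ≤ n) :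
    ((neutralSlots r σ).filter (fun o => p ≤ o)).card =
      ((rDesSet r σ).filter (fun d => p ≤ d)).card +
        ((Finset.Ioc p n).filter (fun j => n + 1 < pval σ j + r)).card + 1 := by
  have h : (neutralSlots r σ).filter (fun o => p ≤ o) =
      insert n (((rDesSet r σ).filter (fun d => p ≤ d)) ∪
        ((Finset.Ioc p n).filter (fun j => n + 1 < pval σ j + r)).image (fun j => j - 1)) := by
    ext o
    simp only [neutralSlots, Finset.mem_filter, Finset.mem_range, Finset.mem_insert,
      Finset.mem_union, Finset.mem_image, Finset.mem_Ioc]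
    constructor
    · rintro ⟨⟨h1, h2 | h2 | h2⟩, h3⟩
      · exact Or.inl h2
      · exact Or.inr (Or.inl ⟨h2, h3⟩)
      · by_cases ho : o = n
        · exact Or.inl ho
        · exact Or.inr (Or.inr ⟨o + 1, ⟨⟨by omega, by omega⟩, h2⟩, by omega⟩)
    · rintro (rfl | ⟨h1, h2⟩ | ⟨j, ⟨⟨h1, h2⟩, h3⟩, rfl⟩)
      · exact ⟨⟨by omega, Or.inl rfl⟩, hp⟩
      · have := (mem_rDesSet.1 h1).2.1
        exact ⟨⟨by omega, Or.inr (Or.inl h1)⟩, h2⟩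
      · refine ⟨⟨by omega, Or.inr (Or.inr ?_)⟩, by omega⟩
        rwa [Nat.sub_add_cancel (by omega)]
  rw [h, Finset.card_insert_of_notMem, Finset.card_union_of_disjoint,
    Finset.card_image_of_injOn]
  · intro a ha b hb hab
    simp only [Finset.coe_filter, Finset.mem_Ioc, Set.mem_ofPred_eq] at ha hb hab
    omega
  · rw [Finset.disjoint_left]
    intro d hd hd'
    simp only [Finset.mem_image, Finset.mem_filter, Finset.mem_Ioc, mem_rDesSet] at hd hd'
    obtain ⟨j, ⟨⟨h1, h2⟩, h3⟩, rfl⟩ := hd'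
    rw [Nat.sub_add_cancel (by omega)] at hd
    have := pval_le σ (j - 1)
    omega
  · simp only [Finset.mem_union, Finset.mem_image, Finset.mem_filter, Finset.mem_Ioc, mem_rDesSet]
    omega

theorem card_neutralSlots {r : ℕ} (hr : 1 ≤ r) (hrn : r ≤ n + 1) (σ : Equiv.Perm (Fin n)) :
    (neutralSlots r σ).card = rdes r σ + r := by
  have h := card_neutralSlots_ge (r := r) σ (Nat.zero_le n)
  have h1 : (Finset.Ioc 0 n).filter (fun j => n + 1 < pval σ j + r) =
      (Finset.Icc 1 n).filter (fun j => n + 1 < pval σ j + r) := rfl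
  have h2 : (Finset.Icc 1 n).filter (fun v => n + 1 < v + r) = Finset.Icc (n + 2 - r) n := by
    ext v
    simp only [Finset.mem_filter, Finset.mem_Icc]
    omega
  rw [h1, card_filter_pval σ (fun v => n + 1 < v + r), h2] at h
  simp only [Nat.zero_le, Finset.filter_true, Nat.card_Icc] at h
  rw [h, rdes]
  omega

theorem rmaj_insertMax_of_mem {r : ℕ} (hr : 1 ≤ r) (p : Fin (n + 1)) (σ : Equiv.Perm (Fin n))
    (hp : (p : ℕ) ∈ neutralSlots r σ) :
    rmaj r (insertMax p σ) =
      rmaj r σ + ((neutralSlots r σ).filter (fun o => (p : ℕ) < o)).card := by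
  have h := card_neutralSlots_ge (r := r) σ (p := p) (by omega)
  have h1 : (neutralSlots r σ).filter (fun o => (p : ℕ) ≤ o) =
      insert (p : ℕ) ((neutralSlots r σ).filter (fun o => (p : ℕ) < o)) := by
    ext o
    simp only [Finset.mem_filter, Finset.mem_insert]
    constructor
    · rintro ⟨ho, h⟩
      rcases h.eq_or_lt with h | h
      · exact Or.inl h.symm
      · exact Or.inr ⟨ho, h⟩
    · rintro (rfl | ⟨ho, h⟩)
      · exact ⟨hp, le_rfl⟩
      · exact ⟨ho, h.le⟩
  rw [h1, Finset.card_insert_of_notMem (by simp)] at h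
  rw [rmaj, rmaj, sum_rDesSet_insertMax hr, card_rInvSet_insertMax, if_pos hp]
  omega

theorem rmaj_insertMax_of_notMem {r : ℕ} (hr : 1 ≤ r) (p : Fin (n + 1))
    (σ : Equiv.Perm (Fin n)) (hp : (p : ℕ) ∉ neutralSlots r σ) :
    rmaj r (insertMax p σ) = rmaj r σ + ((neutralSlots r σ).card +
      ((Finset.range (n + 1) \ neutralSlots r σ).filter (fun o => o < (p : ℕ))).card) := by
  have h := card_neutralSlots_ge (r := r) σ (p := p) (by omega)
  have h1 := Finset.card_filter_add_card_filter_not (s := neutralSlots r σ)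
    (fun o => (p : ℕ) ≤ o)
  have h2 : Finset.range p =
      ((Finset.range (n + 1) \ neutralSlots r σ).filter (fun o => o < (p : ℕ))) ∪
        (neutralSlots r σ).filter (fun o => ¬ (p : ℕ) ≤ o) := by
    ext o
    have := p.2
    by_cases ho : o ∈ neutralSlots r σ <;>
      simp only [Finset.mem_union, Finset.mem_filter, Finset.mem_sdiff, Finset.mem_range, ho,
        not_true_eq_false, not_false_eq_true, and_false, and_true, false_and, true_and, false_or,
        or_false] <;>
      omega
  have h3 := congrArg Finset.card h2
  rw [Finset.card_range, Finset.card_union_of_disjoint] at h3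
  · rw [rmaj, rmaj, sum_rDesSet_insertMax hr, card_rInvSet_insertMax, if_neg hp]
    omega
  · rw [Finset.disjoint_left]
    intro o ho ho'
    exact (Finset.mem_sdiff.1 (Finset.mem_filter.1 ho).1).2 (Finset.mem_filter.1 ho').1

/-- The joint generating function of `rdes` and `rmaj` on `S_n`. -/
def rMajSum {A : Type*} [CommRing A] (r : ℕ) (q t : A) (n : ℕ) : A :=
  ∑ π : Equiv.Perm (Fin n), t ^ rdes r π * q ^ rmaj r π

theorem sum_insertMax {A : Type*} [CommRing A] {r : ℕ} (hr : 1 ≤ r) (q t : A)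
    (σ : Equiv.Perm (Fin n)) :
    ∑ p : Fin (n + 1), t ^ rdes r (insertMax p σ) * q ^ rmaj r (insertMax p σ) =
      t ^ rdes r σ * q ^ rmaj r σ * (qNat q (neutralSlots r σ).card +
        t * q ^ (neutralSlots r σ).card * qNat q (n + 1 - (neutralSlots r σ).card)) := by
  have hsub : neutralSlots r σ ⊆ Finset.range (n + 1) := Finset.filter_subset _ _
  have hcard : (Finset.range (n + 1) \ neutralSlots r σ).card =
      n + 1 - (neutralSlots r σ).card := by
    rw [Finset.card_sdiff_of_subset hsub, Finset.card_range]
  rw [← hcard, ← sum_pow_card_filter_gt, ← sum_pow_card_filter_lt, mul_add, Finset.mul_sum,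
    Finset.mul_sum]
  let G : ℕ → A := fun p => if p ∈ neutralSlots r σ then
      t ^ rdes r σ * q ^ rmaj r σ * q ^ ((neutralSlots r σ).filter (fun o => p < o)).card
    else t ^ rdes r σ * q ^ rmaj r σ * (t * q ^ (neutralSlots r σ).card *
      q ^ ((Finset.range (n + 1) \ neutralSlots r σ).filter (fun o => o < p)).card)
  have hterm : ∀ p : Fin (n + 1),
      t ^ rdes r (insertMax p σ) * q ^ rmaj r (insertMax p σ) = G p := by
    intro p
    by_cases hp : (p : ℕ) ∈ neutralSlots r σ
    · simp only [G, hp, if_true]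
      rw [rdes_insertMax hr, if_pos hp, rmaj_insertMax_of_mem hr p σ hp]
      ring
    · simp only [G, hp, if_false]
      rw [rdes_insertMax hr, if_neg hp, rmaj_insertMax_of_notMem hr p σ hp]
      ring
  rw [Finset.sum_congr rfl (fun p _ => hterm p), Fin.sum_univ_eq_sum_range G,
    ← Finset.sum_sdiff hsub, add_comm]
  congr 1
  · exact Finset.sum_congr rfl fun p hp => if_pos hp
  · rw [Finset.mul_sum]
    exact Finset.sum_congr rfl fun p hp => if_neg (Finset.mem_sdiff.1 hp).2

theorem rMajSum_succ_eq_sum {A : Type*} [CommRing A] {r : ℕ} (hr : 1 ≤ r) (q t : A) (n : ℕ) :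
    rMajSum r q t (n + 1) = ∑ σ : Equiv.Perm (Fin n),
      t ^ rdes r σ * q ^ rmaj r σ * (qNat q (neutralSlots r σ).card +
        t * q ^ (neutralSlots r σ).card * qNat q (n + 1 - (neutralSlots r σ).card)) := by
  rw [rMajSum, ← insertMax_bijective.sum_comp, Fintype.sum_prod_type_right]
  exact Finset.sum_congr rfl fun σ _ => sum_insertMax hr q t σ

theorem rMajSum_of_lt {A : Type*} [CommRing A] {r : ℕ} (hr : 1 ≤ r) (q t : A) (hn : n < r) :
    rMajSum r q t (n + 1) = qNat q (n + 1) * rMajSum r q t n := by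
  rw [rMajSum_succ_eq_sum hr, rMajSum, Finset.mul_sum]
  refine Finset.sum_congr rfl fun σ _ => ?_
  have : neutralSlots r σ = Finset.range (n + 1) := by
    refine Finset.filter_true_of_mem fun p hp => ?_
    by_cases h : p = n
    · exact Or.inl h
    · have := Finset.mem_range.1 hp
      have := pval_pos σ (i := p + 1) (by omega) (by omega)
      exact Or.inr (Or.inr (by omega))
  rw [this, Finset.card_range, Nat.sub_self, qNat_zero]
  ring

/-- Rawlings' recursion. -/
theorem rMajSum_recursion {A : Type*} [CommRing A] {r : ℕ} (hr : 1 ≤ r) (q t : A)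
    (hn : r ≤ n + 1) :
    (1 - q) * rMajSum r q t (n + 1) = (1 - t * q ^ (n + 1)) * rMajSum r q t n -
      q ^ r * (1 - t) * rMajSum r q (t * q) n := by
  rw [rMajSum_succ_eq_sum hr]
  simp only [rMajSum, Finset.mul_sum, ← Finset.sum_sub_distrib]
  refine Finset.sum_congr rfl fun σ _ => ?_
  have hle : (neutralSlots r σ).card ≤ n + 1 := by
    have hsub : neutralSlots r σ ⊆ Finset.range (n + 1) := Finset.filter_subset _ _
    simpa using Finset.card_le_card hsub
  have h1 := one_sub_mul_qNat q (neutralSlots r σ).card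
  have h2 := one_sub_mul_qNat q (n + 1 - (neutralSlots r σ).card)
  have h3 : q ^ (n + 1) = q ^ (neutralSlots r σ).card *
      q ^ (n + 1 - (neutralSlots r σ).card) := by
    rw [← pow_add, Nat.add_sub_cancel' hle]
  rw [h3]
  have h4 : q ^ (neutralSlots r σ).card = q ^ rdes r σ * q ^ r := by
    rw [card_neutralSlots hr hn, pow_add]
  rw [mul_pow]
  linear_combination t ^ rdes r σ * q ^ rmaj r σ * h1 +
    t ^ rdes r σ * q ^ rmaj r σ * t * q ^ (neutralSlots r σ).card * h2 +
    t ^ rdes r σ * q ^ rmaj r σ * (t - 1) * h4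

end Insertion

/-- The placements of non-attacking rooks on the board `[a] × [c]`. -/
def rooks (a c : ℕ) : Finset (Finset (ℕ × ℕ)) :=
  (Finset.Icc 1 a ×ˢ Finset.Icc 1 c).powerset.filter
    (fun R => ∀ x ∈ R, ∀ y ∈ R, x.1 = y.1 ∨ x.2 = y.2 → x = y)

/-- The rows of a board with `a` rows which contain no rook of `R`. -/
def openRows (a : ℕ) (R : Finset (ℕ × ℕ)) : Finset ℕ :=
  (Finset.Icc 1 a).filter (fun p => ∀ x ∈ R, x.1 ≠ p)

/-- The columns of a board with `c` columns which contain no rook of `R`. -/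
def openCols (c : ℕ) (R : Finset (ℕ × ℕ)) : Finset ℕ :=
  (Finset.Icc 1 c).filter (fun w => ∀ x ∈ R, x.2 ≠ w)

section Rooks

theorem mem_rooks {a c : ℕ} {R : Finset (ℕ × ℕ)} :
    R ∈ rooks a c ↔ (∀ x ∈ R, (1 ≤ x.1 ∧ x.1 ≤ a) ∧ 1 ≤ x.2 ∧ x.2 ≤ c) ∧
      ∀ x ∈ R, ∀ y ∈ R, x.1 = y.1 ∨ x.2 = y.2 → x = y := by
  simp only [rooks, Finset.mem_filter, Finset.mem_powerset, Finset.subset_iff,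
    Finset.mem_product, Finset.mem_Icc]

theorem mem_openRows {a p : ℕ} {R : Finset (ℕ × ℕ)} :
    p ∈ openRows a R ↔ (1 ≤ p ∧ p ≤ a) ∧ ∀ x ∈ R, x.1 ≠ p := by
  simp only [openRows, Finset.mem_filter, Finset.mem_Icc]

theorem mem_openCols {c w : ℕ} {R : Finset (ℕ × ℕ)} :
    w ∈ openCols c R ↔ (1 ≤ w ∧ w ≤ c) ∧ ∀ x ∈ R, x.2 ≠ w := by
  simp only [openCols, Finset.mem_filter, Finset.mem_Icc]

theorem insert_mem_rooks {a c w : ℕ} {R : Finset (ℕ × ℕ)} (hR : R ∈ rooks a c)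
    (hw : w ∈ openCols c R) : insert (a + 1, w) R ∈ rooks (a + 1) c := by
  rw [mem_rooks] at hR ⊢
  rw [mem_openCols] at hw
  constructor
  · intro x hx
    rcases Finset.mem_insert.1 hx with rfl | hx
    · exact ⟨⟨by simp, le_rfl⟩, hw.1⟩
    · have := hR.1 x hx
      exact ⟨⟨this.1.1, by omega⟩, this.2⟩
  · intro x hx y hy hxy
    rcases Finset.mem_insert.1 hx with rfl | hx <;> rcases Finset.mem_insert.1 hy with rfl | hy
    · rfl
    · have := hR.1 y hy
      have := hw.2 y hy
      simp only at hxy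
      omega
    · have := hR.1 x hx
      have := hw.2 x hx
      simp only at hxy
      omega
    · exact hR.2 x hx y hy hxy

theorem filter_rooks_openRow (a c : ℕ) :
    (rooks (a + 1) c).filter (fun R => ∀ x ∈ R, x.1 ≠ a + 1) = rooks a c := by
  ext R
  rw [Finset.mem_filter, mem_rooks, mem_rooks]
  constructor
  · rintro ⟨⟨h1, h2⟩, h3⟩
    refine ⟨fun x hx => ?_, h2⟩
    have := h1 x hx
    have := h3 x hx
    omega
  · rintro ⟨h1, h2⟩
    refine ⟨⟨fun x hx => ?_, h2⟩, fun x hx => ?_⟩ <;> have := h1 x hx <;> omega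

theorem sum_rooks_succ_row {M : Type*} [AddCommMonoid M] (a c : ℕ)
    (F : Finset (ℕ × ℕ) → M) :
    ∑ R ∈ rooks (a + 1) c, F R =
      ∑ R ∈ rooks a c, (F R + ∑ w ∈ openCols c R, F (insert (a + 1, w) R)) := by
  rw [Finset.sum_add_distrib, ← Finset.sum_filter_add_sum_filter_not (rooks (a + 1) c)
    (fun R => ∀ x ∈ R, x.1 ≠ a + 1), filter_rooks_openRow, Finset.sum_sigma']
  congr 1
  symm
  refine Finset.sum_bij (fun (y : (_ : Finset (ℕ × ℕ)) × ℕ) _ => insert (a + 1, y.2) y.1)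
    ?_ ?_ ?_ (fun _ _ => rfl)
  · rintro ⟨R, w⟩ h
    rw [Finset.mem_sigma] at h
    refine Finset.mem_filter.2 ⟨insert_mem_rooks h.1 h.2, fun h' => ?_⟩
    exact h' _ (Finset.mem_insert_self _ _) rfl
  · rintro ⟨R, w⟩ h ⟨R', w'⟩ h' heq
    rw [Finset.mem_sigma] at h h'
    simp only at h h' heq
    have hR : ∀ x ∈ R, x.1 ≠ a + 1 := fun x hx => by
      have := (mem_rooks.1 h.1).1 x hx
      omega
    have hR' : ∀ x ∈ R', x.1 ≠ a + 1 := fun x hx => by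
      have := (mem_rooks.1 h'.1).1 x hx
      omega
    have hw : w = w' := by
      have h1 : (a + 1, w) ∈ insert (a + 1, w') R' := heq ▸ Finset.mem_insert_self _ _
      rcases Finset.mem_insert.1 h1 with h2 | h2
      · simpa using h2
      · exact absurd rfl (hR' _ h2)
    subst hw
    have hRR : R = R' := by
      rw [← Finset.erase_insert (fun hx => hR _ hx rfl : (a + 1, w) ∉ R), heq,
        Finset.erase_insert (fun hx => hR' _ hx rfl)]
    rw [hRR]
  · intro R hR
    rw [Finset.mem_filter] at hR
    obtain ⟨hR, h⟩ := hR
    push Not at h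
    obtain ⟨⟨p, w⟩, hx, hp⟩ := h
    simp only at hp
    subst hp
    have hR' := mem_rooks.1 hR
    refine ⟨⟨R.erase (a + 1, w), w⟩, Finset.mem_sigma.2 ⟨?_, ?_⟩, Finset.insert_erase hx⟩
    · rw [mem_rooks]
      refine ⟨fun x hx' => ?_, fun x hx y hy => hR'.2 x (Finset.mem_of_mem_erase hx) y
        (Finset.mem_of_mem_erase hy)⟩
      have h1 := hR'.1 x (Finset.mem_of_mem_erase hx')
      have h2 : x.1 ≠ a + 1 := fun h => Finset.ne_of_mem_erase hx'
        (hR'.2 x (Finset.mem_of_mem_erase hx') _ hx (Or.inl h))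
      omega
    · rw [mem_openCols]
      refine ⟨(hR'.1 _ hx).2, fun x hx' h => Finset.ne_of_mem_erase hx'
        (hR'.2 x (Finset.mem_of_mem_erase hx') _ hx (Or.inr h))⟩

theorem image_swap_image_swap (R : Finset (ℕ × ℕ)) :
    (R.image Prod.swap).image Prod.swap = R := by
  rw [Finset.image_image, Prod.swap_swap_eq, Finset.image_id]

theorem image_swap_mem_rooks {a c : ℕ} {R : Finset (ℕ × ℕ)} (hR : R ∈ rooks a c) :
    R.image Prod.swap ∈ rooks c a := by
  rw [mem_rooks] at hR ⊢
  simp only [Finset.forall_mem_image, Prod.fst_swap, Prod.snd_swap]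
  exact ⟨fun x hx => (hR.1 x hx).symm, fun x hx y hy h => by rw [hR.2 x hx y hy h.symm]⟩

theorem sum_rooks_swap {M : Type*} [AddCommMonoid M] (a c : ℕ) (F : Finset (ℕ × ℕ) → M) :
    ∑ R ∈ rooks a c, F R = ∑ R ∈ rooks c a, F (R.image Prod.swap) :=
  Finset.sum_nbij' (fun R => R.image Prod.swap) (fun R => R.image Prod.swap)
    (fun _ h => image_swap_mem_rooks h) (fun _ h => image_swap_mem_rooks h)
    (fun R _ => image_swap_image_swap R) (fun R _ => image_swap_image_swap R)
    (fun R _ => by rw [image_swap_image_swap])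

theorem openCols_image_swap (c : ℕ) (R : Finset (ℕ × ℕ)) :
    openCols c (R.image Prod.swap) = openRows c R := by
  ext w
  simp only [mem_openCols, mem_openRows, Finset.forall_mem_image, Prod.snd_swap]

theorem sum_rooks_succ_col {M : Type*} [AddCommMonoid M] (a c : ℕ)
    (F : Finset (ℕ × ℕ) → M) :
    ∑ R ∈ rooks a (c + 1), F R =
      ∑ R ∈ rooks a c, (F R + ∑ p ∈ openRows a R, F (insert (p, c + 1) R)) := by
  rw [sum_rooks_swap, sum_rooks_succ_row, sum_rooks_swap]
  refine Finset.sum_congr rfl fun R _ => ?_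
  simp only [Finset.image_insert, image_swap_image_swap, openCols_image_swap, Prod.swap_prod_mk]

theorem card_openRows_add_card {a c : ℕ} {R : Finset (ℕ × ℕ)} (hR : R ∈ rooks a c) :
    (openRows a R).card + R.card = a := by
  rw [mem_rooks] at hR
  have h1 : openRows a R = Finset.Icc 1 a \ R.image Prod.fst := by
    ext p
    simp only [mem_openRows, Finset.mem_sdiff, Finset.mem_Icc, Finset.mem_image, not_exists,
      not_and, ne_eq]
  have h2 : R.image Prod.fst ⊆ Finset.Icc 1 a := by
    intro p hp
    obtain ⟨x, hx, rfl⟩ := Finset.mem_image.1 hp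
    exact Finset.mem_Icc.2 (hR.1 x hx).1
  have h3 : (R.image Prod.fst).card = R.card :=
    Finset.card_image_of_injOn fun x hx y hy h => hR.2 x hx y hy (Or.inl h)
  have h4 := Finset.card_le_card h2
  rw [h1, Finset.card_sdiff_of_subset h2, h3, Nat.card_Icc]
  rw [h3, Nat.card_Icc] at h4
  omega

theorem card_openCols_add_card {a c : ℕ} {R : Finset (ℕ × ℕ)} (hR : R ∈ rooks a c) :
    (openCols c R).card + R.card = c := by
  have h := card_openRows_add_card (image_swap_mem_rooks hR)
  rwa [← openCols_image_swap, image_swap_image_swap,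
    Finset.card_image_of_injective _ Prod.swap_injective] at h

theorem openRows_succ {a c : ℕ} {R : Finset (ℕ × ℕ)} (hR : R ∈ rooks a c) :
    openRows (a + 1) R = insert (a + 1) (openRows a R) := by
  rw [mem_rooks] at hR
  ext p
  rw [mem_openRows, Finset.mem_insert, mem_openRows]
  constructor
  · rintro ⟨h1, h2⟩
    by_cases hp : p = a + 1
    · exact Or.inl hp
    · exact Or.inr ⟨by omega, h2⟩
  · rintro (rfl | ⟨h1, h2⟩)
    · refine ⟨by omega, fun x hx => ?_⟩
      have := hR.1 x hx
      omega
    · exact ⟨by omega, h2⟩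

theorem notMem_openRows_succ (a : ℕ) (R : Finset (ℕ × ℕ)) : a + 1 ∉ openRows a R := by
  rw [mem_openRows]
  omega

theorem openRows_insert_row (a w : ℕ) (R : Finset (ℕ × ℕ)) :
    openRows (a + 1) (insert (a + 1, w) R) = openRows a R := by
  ext p
  simp only [mem_openRows, Finset.forall_mem_insert]
  constructor
  · rintro ⟨h1, h2, h3⟩
    exact ⟨by omega, h3⟩
  · rintro ⟨h1, h3⟩
    exact ⟨by omega, by omega, h3⟩

theorem openRows_insert_col (a p c : ℕ) (R : Finset (ℕ × ℕ)) :
    openRows a (insert (p, c) R) = (openRows a R).erase p := by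
  ext i
  simp only [mem_openRows, Finset.forall_mem_insert, Finset.mem_erase]
  constructor
  · rintro ⟨h1, h2, h3⟩
    exact ⟨h2.symm, h1, h3⟩
  · rintro ⟨h1, h2, h3⟩
    exact ⟨h2, h1.symm, h3⟩

end Rooks

/-- The weight of an excedance place. -/
def rowWeight {A : Type*} [CommRing A] (r : ℕ) (q t : A) (p : ℕ) : A :=
  (if r ≤ p then t else 1) * q ^ p

/-- The weight of a rook `x` in the placement `R`; the rooks that are `r`-level excedances
count the larger letters on their left, the others the smaller letters on their right. -/
def cellWeight {A : Type*} [CommRing A] (r : ℕ) (q t : A) (R : Finset (ℕ × ℕ)) (x : ℕ × ℕ) : A :=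
  if x.1 < x.2 ∧ r ≤ x.2 then
    rowWeight r q t x.1 *
      q ^ ((Finset.Ico 1 x.1).filter (fun i => ∀ y ∈ R, y.1 = i → x.2 ≤ y.2)).card
  else q ^ ((Finset.Ico 1 x.2).filter (fun b => ∀ y ∈ R, y.2 = b → x.1 ≤ y.1)).card

/-- The weight of a rook placement on a board with `a` rows, where every open row will
eventually contain an excedance. -/
def rookWeight {A : Type*} [CommRing A] (r : ℕ) (q t : A) (a : ℕ) (R : Finset (ℕ × ℕ)) : A :=
  (∏ x ∈ R, cellWeight r q t R x) * ∏ p ∈ openRows a R, rowWeight r q t p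

/-- The total weight of the rook placements on `[a] × [c]` with `h` open rows. -/
def rookSum {A : Type*} [CommRing A] (r : ℕ) (q t : A) (a c h : ℕ) : A :=
  ∑ R ∈ rooks a c, if (openRows a R).card = h then rookWeight r q t a R else 0

section RookSum

variable {A : Type*} [CommRing A] {r : ℕ} {q t : A}

theorem cellWeight_insert_row {a c w : ℕ} {R : Finset (ℕ × ℕ)} (hR : R ∈ rooks a c)
    {x : ℕ × ℕ} (hx : x ∈ R) :
    cellWeight r q t (insert (a + 1, w) R) x = cellWeight r q t R x := by
  rw [mem_rooks] at hR
  have hx' := hR.1 x hx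
  obtain ⟨R', hR'⟩ : ∃ R', R' = insert (a + 1, w) R := ⟨_, rfl⟩
  rw [← hR']
  have h1 : (Finset.Ico 1 x.1).filter
      (fun i => ∀ y ∈ R', y.1 = i → x.2 ≤ y.2) =
      (Finset.Ico 1 x.1).filter (fun i => ∀ y ∈ R, y.1 = i → x.2 ≤ y.2) := by
    refine Finset.filter_congr fun i hi => ?_
    rw [Finset.mem_Ico] at hi
    rw [hR', Finset.forall_mem_insert]
    exact and_iff_right (by simp only; omega)
  have h2 : (Finset.Ico 1 x.2).filter
      (fun b => ∀ y ∈ R', y.2 = b → x.1 ≤ y.1) =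
      (Finset.Ico 1 x.2).filter (fun b => ∀ y ∈ R, y.2 = b → x.1 ≤ y.1) := by
    refine Finset.filter_congr fun b hb => ?_
    rw [hR', Finset.forall_mem_insert]
    exact and_iff_right (by simp only; omega)
  rw [cellWeight, cellWeight, h1, h2]

theorem cellWeight_insert_col {a c p : ℕ} {R : Finset (ℕ × ℕ)} (hR : R ∈ rooks a c)
    {x : ℕ × ℕ} (hx : x ∈ R) :
    cellWeight r q t (insert (p, c + 1) R) x = cellWeight r q t R x := by
  rw [mem_rooks] at hR
  have hx' := hR.1 x hx
  obtain ⟨R', hR'⟩ : ∃ R', R' = insert (p, c + 1) R := ⟨_, rfl⟩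
  rw [← hR']
  have h1 : (Finset.Ico 1 x.1).filter
      (fun i => ∀ y ∈ R', y.1 = i → x.2 ≤ y.2) =
      (Finset.Ico 1 x.1).filter (fun i => ∀ y ∈ R, y.1 = i → x.2 ≤ y.2) := by
    refine Finset.filter_congr fun i hi => ?_
    rw [hR', Finset.forall_mem_insert]
    exact and_iff_right (by simp only; omega)
  have h2 : (Finset.Ico 1 x.2).filter
      (fun b => ∀ y ∈ R', y.2 = b → x.1 ≤ y.1) =
      (Finset.Ico 1 x.2).filter (fun b => ∀ y ∈ R, y.2 = b → x.1 ≤ y.1) := by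
    refine Finset.filter_congr fun b hb => ?_
    rw [Finset.mem_Ico] at hb
    rw [hR', Finset.forall_mem_insert]
    exact and_iff_right (by simp only; omega)
  rw [cellWeight, cellWeight, h1, h2]

theorem cellWeight_new_row {a c w : ℕ} (hc : c ≤ a + 1 ∨ c < r) {R : Finset (ℕ × ℕ)}
    (hR : R ∈ rooks a c) (hw : w ∈ openCols c R) :
    cellWeight r q t (insert (a + 1, w) R) (a + 1, w) =
      q ^ ((openCols c R).filter (fun b => b < w)).card := by
  rw [mem_rooks] at hR
  rw [mem_openCols] at hw
  rw [cellWeight, if_neg (by simp only; omega)]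
  congr 2
  ext b
  simp only [Finset.mem_filter, Finset.mem_Ico, Finset.forall_mem_insert, mem_openCols]
  constructor
  · rintro ⟨h1, -, h2⟩
    refine ⟨⟨by omega, fun x hx h => ?_⟩, h1.2⟩
    have := h2 x hx h
    have := hR.1 x hx
    omega
  · rintro ⟨⟨h1, h2⟩, h3⟩
    exact ⟨by omega, by omega, fun x hx h => absurd h (h2 x hx)⟩

theorem cellWeight_new_col {a c p : ℕ} (hac : a ≤ c) (hrc : r ≤ c + 1) {R : Finset (ℕ × ℕ)}
    (hR : R ∈ rooks a c) (hp : p ∈ openRows a R) :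
    cellWeight r q t (insert (p, c + 1) R) (p, c + 1) =
      rowWeight r q t p * q ^ ((openRows a R).filter (fun i => i < p)).card := by
  rw [mem_rooks] at hR
  rw [mem_openRows] at hp
  rw [cellWeight, if_pos (by simp only; omega)]
  congr 3
  ext b
  simp only [Finset.mem_filter, Finset.mem_Ico, Finset.forall_mem_insert, mem_openRows]
  constructor
  · rintro ⟨h1, -, h2⟩
    refine ⟨⟨by omega, fun x hx h => ?_⟩, h1.2⟩
    have := h2 x hx h
    have := hR.1 x hx
    omega
  · rintro ⟨⟨h1, h2⟩, h3⟩
    exact ⟨by omega, by omega, fun x hx h => absurd h (h2 x hx)⟩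

theorem rookWeight_succ {a c : ℕ} {R : Finset (ℕ × ℕ)} (hR : R ∈ rooks a c) :
    rookWeight r q t (a + 1) R = rowWeight r q t (a + 1) * rookWeight r q t a R := by
  rw [rookWeight, openRows_succ hR, Finset.prod_insert (notMem_openRows_succ a R), rookWeight]
  ring

theorem rookWeight_insert_row {a c w : ℕ} (hc : c ≤ a + 1 ∨ c < r) {R : Finset (ℕ × ℕ)}
    (hR : R ∈ rooks a c) (hw : w ∈ openCols c R) :
    rookWeight r q t (a + 1) (insert (a + 1, w) R) =
      rookWeight r q t a R * q ^ ((openCols c R).filter (fun b => b < w)).card := by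
  have hnot : (a + 1, w) ∉ R := fun h => (mem_openCols.1 hw).2 _ h rfl
  rw [rookWeight, Finset.prod_insert hnot, cellWeight_new_row hc hR hw, openRows_insert_row,
    Finset.prod_congr rfl (fun x hx => cellWeight_insert_row hR hx), rookWeight]
  ring

theorem rookWeight_insert_col {a c p : ℕ} (hac : a ≤ c) (hrc : r ≤ c + 1)
    {R : Finset (ℕ × ℕ)} (hR : R ∈ rooks a c) (hp : p ∈ openRows a R) :
    rookWeight r q t a (insert (p, c + 1) R) =
      rookWeight r q t a R * q ^ ((openRows a R).filter (fun i => i < p)).card := by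
  have hnot : (p, c + 1) ∉ R := fun h => (mem_openRows.1 hp).2 _ h rfl
  rw [rookWeight, Finset.prod_insert hnot, cellWeight_new_col hac hrc hR hp,
    openRows_insert_col, Finset.prod_congr rfl (fun x hx => cellWeight_insert_col hR hx),
    rookWeight, ← Finset.mul_prod_erase _ _ hp]
  ring

theorem rookSum_succ_row {a c : ℕ} (hc : c ≤ a + 1 ∨ c < r) (h : ℕ) :
    rookSum r q t (a + 1) c h = qNat q (c + h - a) * rookSum r q t a c h +
      rowWeight r q t (a + 1) * shiftRight (rookSum r q t a c) h := by
  have hshift : shiftRight (rookSum r q t a c) h =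
      ∑ R ∈ rooks a c, if (openRows a R).card + 1 = h then rookWeight r q t a R else 0 := by
    rcases h with _ | h
    · simp [shiftRight]
    · simp [shiftRight, rookSum]
  rw [hshift, rookSum, sum_rooks_succ_row, rookSum, Finset.mul_sum, Finset.mul_sum,
    ← Finset.sum_add_distrib]
  refine Finset.sum_congr rfl fun R hR => ?_
  rw [add_comm, openRows_succ hR, Finset.card_insert_of_notMem (notMem_openRows_succ a R),
    rookWeight_succ hR, mul_ite, mul_zero, mul_ite, mul_zero]
  congr 1
  simp only [openRows_insert_row]
  split_ifs with hh
  · have h1 := card_openRows_add_card hR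
    have h2 := card_openCols_add_card hR
    have h3 : c + h - a = (openCols c R).card := by omega
    rw [h3, ← sum_pow_card_filter_lt, Finset.sum_mul]
    refine Finset.sum_congr rfl fun w hw => ?_
    rw [rookWeight_insert_row hc hR hw, mul_comm]
  · exact Finset.sum_const_zero

theorem rookSum_succ_col {a c : ℕ} (hac : a ≤ c) (hrc : r ≤ c + 1) (h : ℕ) :
    rookSum r q t a (c + 1) h =
      rookSum r q t a c h + qNat q (h + 1) * rookSum r q t a c (h + 1) := by
  rw [rookSum, sum_rooks_succ_col, Finset.sum_add_distrib, rookSum, rookSum, Finset.mul_sum]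
  congr 1
  refine Finset.sum_congr rfl fun R hR => ?_
  rw [mul_ite, mul_zero]
  by_cases hh : (openRows a R).card = h + 1
  · rw [if_pos hh, ← hh, ← sum_pow_card_filter_lt, Finset.sum_mul]
    refine Finset.sum_congr rfl fun p hp => ?_
    rw [openRows_insert_col, Finset.card_erase_of_mem hp, if_pos (by omega),
      rookWeight_insert_col hac hrc hR hp, mul_comm]
  · rw [if_neg hh]
    refine Finset.sum_eq_zero fun p hp => if_neg ?_
    rw [openRows_insert_col, Finset.card_erase_of_mem hp]
    have := Finset.card_pos.2 ⟨p, hp⟩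
    omega

theorem rookSum_diag_succ {i : ℕ} (hi : r ≤ i + 1) :
    rookSum r q t (i + 1) (i + 1) =
      motzkinStep q (t * q ^ (i + 1)) (rookSum r q t i i) := by
  funext h
  have hcol : rookSum r q t i (i + 1) =
      fun h => rookSum r q t i i h + qNat q (h + 1) * rookSum r q t i i (h + 1) :=
    funext fun h => rookSum_succ_col le_rfl hi h
  have h1 : i + 1 + h - i = h + 1 := by omega
  rw [rookSum_succ_row (Or.inl le_rfl), hcol, h1, rowWeight, if_pos hi, motzkinStep]
  rcases h with _ | h
  · simp only [shiftRight, qNat_zero]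
    ring
  · simp only [shiftRight]
    ring

theorem rookSum_diag_eq_motzkinIter (ρ m : ℕ) :
    rookSum (ρ + 1) q t (ρ + m) (ρ + m) =
      motzkinIter q (t * q ^ (ρ + 1)) (rookSum (ρ + 1) q t ρ ρ) m := by
  induction m with
  | zero => rfl
  | succ m ih =>
    rw [← Nat.add_assoc, rookSum_diag_succ (by omega), ih, motzkinIter]
    congr 1
    ring

theorem rookSum_zero (c h : ℕ) : rookSum r q t 0 c h = if h = 0 then 1 else 0 := by
  have h1 : rooks 0 c = {∅} := by
    ext R
    rw [mem_rooks, Finset.mem_singleton]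
    constructor
    · rintro ⟨h1, -⟩
      refine Finset.eq_empty_of_forall_notMem fun x hx => ?_
      have := h1 x hx
      omega
    · rintro rfl
      simp
  have h2 : openRows 0 ∅ = ∅ := rfl
  simp [rookSum, h1, rookWeight, h2, eq_comm]

theorem rookSum_low_succ {ρ i : ℕ} (hi : i < ρ) (h : ℕ) :
    rookSum (ρ + 1) q t (i + 1) ρ h = qNat q (ρ - (i + 1) + 1 + h) * rookSum (ρ + 1) q t i ρ h +
      q ^ (i + 1) * shiftRight (rookSum (ρ + 1) q t i ρ) h := by
  have h1 : ρ + h - i = ρ - (i + 1) + 1 + h := by omega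
  rw [rookSum_succ_row (Or.inr (Nat.lt_succ_self ρ)), h1, rowWeight, if_neg (by omega), one_mul]

theorem rookSum_low_ratio {ρ i : ℕ} (hi : i ≤ ρ) (a : ℕ) :
    (1 - q) * qNat q (a + 1) * qNat q (ρ - i + (a + 1)) * rookSum (ρ + 1) q t i ρ (a + 1) =
      (q ^ (a + 1) - q ^ (i + 1)) * rookSum (ρ + 1) q t i ρ a := by
  induction i generalizing a with
  | zero =>
    simp only [rookSum_zero]
    rcases a with _ | a <;> simp
  | succ i ih =>
    refine low_rows_ratio q (ρ - (i + 1)) i (rookSum (ρ + 1) q t i ρ) _ (fun a => ?_)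
      (rookSum_low_succ hi) a
    have h1 : ρ - (i + 1) + 1 = ρ - i := by omega
    rw [h1]
    exact ih (by omega) a

theorem rookSum_square_zero (ρ : ℕ) :
    rookSum (ρ + 1) q t ρ ρ 0 = ∏ i ∈ Finset.range ρ, qNat q (i + 1) := by
  have key : ∀ i ≤ ρ, rookSum (ρ + 1) q t i ρ 0 =
      ∏ j ∈ Finset.range i, qNat q (ρ - 1 - j + 1) := by
    intro i hi
    induction i with
    | zero => simp [rookSum_zero]
    | succ i ih =>
      have h1 : ρ - (i + 1) + 1 + 0 = ρ - 1 - i + 1 := by omega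
      rw [rookSum_low_succ hi, Finset.prod_range_succ, ih (by omega), h1]
      simp [shiftRight, mul_comm]
  rw [key ρ le_rfl, Finset.prod_range_reflect (fun j => qNat q (j + 1))]

/-- The weights of the rook placements satisfy Rawlings' recursion. -/
theorem rookSum_recursion (ρ m : ℕ) :
    (1 - q) * rookSum (ρ + 1) q t (ρ + m + 1) (ρ + m + 1) 0 =
      (1 - t * q ^ (ρ + m + 1)) * rookSum (ρ + 1) q t (ρ + m) (ρ + m) 0 -
        q ^ (ρ + 1) * (1 - t) * rookSum (ρ + 1) q (t * q) (ρ + m) (ρ + m) 0 := by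
  have hlow : rookSum (ρ + 1) q (t * q) ρ ρ = rookSum (ρ + 1) q t ρ ρ := by
    have : ∀ i ≤ ρ, rookSum (ρ + 1) q (t * q) i ρ = rookSum (ρ + 1) q t i ρ := by
      intro i hi
      induction i with
      | zero => funext h; rw [rookSum_zero, rookSum_zero]
      | succ i ih =>
        funext h
        rw [rookSum_low_succ hi, rookSum_low_succ hi, ih (by omega)]
    exact this ρ le_rfl
  have h := motzkinIter_recursion q (ρ + 1) t (rookSum (ρ + 1) q t ρ ρ) (fun a => by
    have := rookSum_low_ratio (q := q) (t := t) (le_refl ρ) a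
    rw [Nat.sub_self, zero_add] at this
    rw [← this]
    ring) m
  have h1 : ρ + 1 + m = ρ + m + 1 := by ring
  rw [Nat.add_assoc ρ m 1, rookSum_diag_eq_motzkinIter, rookSum_diag_eq_motzkinIter,
    rookSum_diag_eq_motzkinIter, hlow, h, h1, Nat.add_assoc ρ m 1]

end RookSum

theorem winv_map_sort (S : Finset ℕ) (f : ℕ → ℕ) :
    winv ((S.sort (· ≤ ·)).map f) =
      ∑ i ∈ S, (S.filter (fun a => a < i ∧ f i < f a)).card := by
  have hlt : ∀ i j, i < j → j < (S.sort (· ≤ ·)).length →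
      (S.sort (· ≤ ·)).getD i 0 < (S.sort (· ≤ ·)).getD j 0 := by
    intro i j hij hj
    rw [List.getD_eq_getElem _ _ (hij.trans hj), List.getD_eq_getElem _ _ hj]
    exact List.pairwise_iff_getElem.1 (Finset.sortedLT_sort S).pairwise i j _ _ hij
  have hmem : ∀ i < (S.sort (· ≤ ·)).length, (S.sort (· ≤ ·)).getD i 0 ∈ S := by
    intro i hi
    rw [List.getD_eq_getElem _ _ hi]
    exact (Finset.mem_sort _).1 (List.getElem_mem hi)
  have hsurj : ∀ x ∈ S, ∃ i < (S.sort (· ≤ ·)).length, (S.sort (· ≤ ·)).getD i 0 = x := by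
    intro x hx
    obtain ⟨i, hi, h⟩ := List.getElem_of_mem ((Finset.mem_sort (· ≤ ·)).2 hx)
    exact ⟨i, hi, by rw [List.getD_eq_getElem _ _ hi, h]⟩
  have hmap : ∀ i < (S.sort (· ≤ ·)).length,
      ((S.sort (· ≤ ·)).map f).getD i 0 = f ((S.sort (· ≤ ·)).getD i 0) := by
    intro i hi
    rw [List.getD_eq_getElem _ _ hi, List.getD_eq_getElem _ _ (by simpa using hi),
      List.getElem_map]
  generalize S.sort (· ≤ ·) = L at *
  have hcard : ∑ i ∈ S, (S.filter (fun a => a < i ∧ f i < f a)).card =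
      ((S ×ˢ S).filter (fun x => x.1 < x.2 ∧ f x.2 < f x.1)).card := by
    simp only [Finset.card_filter, Finset.sum_product_right]
  rw [hcard, winv, List.length_map]
  refine Finset.card_bij (fun x _ => (L.getD x.1 0, L.getD x.2 0)) ?_ ?_ ?_
  · rintro ⟨i, j⟩ h
    simp only [Finset.mem_filter, Finset.mem_product, Finset.mem_range] at h ⊢
    obtain ⟨⟨hi, hj⟩, hij, h⟩ := h
    rw [hmap i hi, hmap j hj] at h
    exact ⟨⟨hmem i hi, hmem j hj⟩, hlt i j hij hj, h⟩
  · have hinj : ∀ i < L.length, ∀ j < L.length, L.getD i 0 = L.getD j 0 → i = j := by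
      intro i hi j hj h
      rcases lt_trichotomy i j with h' | h' | h'
      · exact absurd h (hlt i j h' hj).ne
      · exact h'
      · exact absurd h (hlt j i h' hi).ne'
    rintro ⟨i, j⟩ h ⟨i', j'⟩ h' heq
    simp only [Finset.mem_filter, Finset.mem_product, Finset.mem_range] at h h'
    rw [Prod.mk.injEq] at heq ⊢
    exact ⟨hinj i h.1.1 i' h'.1.1 heq.1, hinj j h.1.2 j' h'.1.2 heq.2⟩
  · rintro ⟨x, y⟩ h
    simp only [Finset.mem_filter, Finset.mem_product] at h
    obtain ⟨⟨hx, hy⟩, hxy, h⟩ := h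
    obtain ⟨i, hi, rfl⟩ := hsurj x hx
    obtain ⟨j, hj, rfl⟩ := hsurj y hy
    refine ⟨(i, j), ?_, rfl⟩
    simp only [Finset.mem_filter, Finset.mem_product, Finset.mem_range]
    refine ⟨⟨hi, hj⟩, ?_, by rwa [hmap i hi, hmap j hj]⟩
    by_contra hij
    rcases (not_lt.1 hij).eq_or_lt with rfl | hij
    · exact lt_irrefl _ hxy
    · exact lt_asymm hxy (hlt j i hij hi)

/-- The graph of a permutation, as a placement of rooks. -/
def permRooks {n : ℕ} (π : Equiv.Perm (Fin n)) : Finset (ℕ × ℕ) :=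
  (Finset.Icc 1 n).image (fun i => (i, pval π i))

section PermRooks

variable {n : ℕ} (π : Equiv.Perm (Fin n))

theorem mem_permRooks {x : ℕ × ℕ} :
    x ∈ permRooks π ↔ (1 ≤ x.1 ∧ x.1 ≤ n) ∧ pval π x.1 = x.2 := by
  simp only [permRooks, Finset.mem_image, Finset.mem_Icc]
  constructor
  · rintro ⟨i, hi, rfl⟩
    exact ⟨hi, rfl⟩
  · rintro ⟨hi, h⟩
    exact ⟨x.1, hi, Prod.ext rfl h⟩

theorem permRooks_mem_rooks : permRooks π ∈ rooks n n := by
  rw [mem_rooks]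
  constructor
  · intro x hx
    obtain ⟨hx, h⟩ := (mem_permRooks π).1 hx
    exact ⟨hx, h ▸ pval_pos π hx.1 hx.2, h ▸ pval_le π _⟩
  · intro x hx y hy hxy
    obtain ⟨hx, h⟩ := (mem_permRooks π).1 hx
    obtain ⟨hy, h'⟩ := (mem_permRooks π).1 hy
    have h1 : x.1 = y.1 := by
      rcases hxy with hxy | hxy
      · exact hxy
      · exact pval_injOn π hx.1 hx.2 hy.1 hy.2 (by rw [h, h', hxy])
    exact Prod.ext h1 (by rw [← h, ← h', h1])

theorem openRows_permRooks : openRows n (permRooks π) = ∅ := by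
  refine Finset.eq_empty_of_forall_notMem fun p hp => ?_
  rw [mem_openRows] at hp
  exact hp.2 (p, pval π p) ((mem_permRooks π).2 ⟨hp.1, rfl⟩) rfl

theorem permRooks_injective : Function.Injective (permRooks (n := n)) := by
  intro π σ h
  refine Equiv.ext fun i => Fin.ext ?_
  have hmem : ((i : ℕ) + 1, pval π (i + 1)) ∈ permRooks σ :=
    h ▸ (mem_permRooks π).2 ⟨⟨by omega, by omega⟩, rfl⟩
  have := ((mem_permRooks σ).1 hmem).2
  simp only [pval_succ] at this
  omega

theorem exists_permRooks_eq {R : Finset (ℕ × ℕ)} (hR : R ∈ rooks n n)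
    (h : openRows n R = ∅) : ∃ π : Equiv.Perm (Fin n), permRooks π = R := by
  rw [mem_rooks] at hR
  have hex : ∀ i : Fin n, ∃ v : Fin n, ((i : ℕ) + 1, (v : ℕ) + 1) ∈ R := by
    intro i
    by_contra hi
    refine Finset.notMem_empty ((i : ℕ) + 1) (h ▸ mem_openRows.2 ⟨⟨by omega, by omega⟩, ?_⟩)
    rintro ⟨p, v⟩ hx rfl
    have hv := (hR.1 _ hx).2
    simp only at hv
    refine hi ⟨⟨v - 1, by omega⟩, ?_⟩
    simpa only [Nat.sub_add_cancel hv.1] using hx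
  choose g hg using hex
  have hinj : Function.Injective g := by
    intro i j hij
    have := hR.2 _ (hg i) _ (hg j) (Or.inr (by simp only [hij]))
    rw [Prod.mk.injEq] at this
    omega
  refine ⟨Equiv.ofBijective g (Finite.injective_iff_bijective.1 hinj), ?_⟩
  have hval : ∀ i : Fin n, pval (Equiv.ofBijective g (Finite.injective_iff_bijective.1 hinj))
      ((i : ℕ) + 1) = g i + 1 := fun i => pval_succ _ i
  ext ⟨p, v⟩
  rw [mem_permRooks]
  constructor
  · rintro ⟨⟨h1, h2⟩, h3⟩
    have := hg ⟨p - 1, by simp only at h1 h2; omega⟩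
    have h4 := hval ⟨p - 1, by simp only at h1 h2; omega⟩
    simp only [Nat.sub_add_cancel h1] at this h3 h4
    rwa [← h3, h4]
  · intro hx
    obtain ⟨⟨h1, h2⟩, -⟩ := hR.1 _ hx
    simp only at h1 h2
    refine ⟨⟨h1, h2⟩, ?_⟩
    have h3 := hg ⟨p - 1, by omega⟩
    have h4 := hval ⟨p - 1, by omega⟩
    simp only [Nat.sub_add_cancel h1] at h3 h4 ⊢
    rw [h4]
    exact (Prod.mk.inj (hR.2 _ h3 _ hx (Or.inl rfl))).2

theorem excr_eq_card_filter {r : ℕ} :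
    excr r π = ((excpSet r π).filter (fun i => r ≤ i)).card := by
  rw [excr, excpSet, Finset.filter_filter]
  congr 1
  refine Finset.filter_congr fun i _ => ?_
  omega

theorem mem_excpSet {r i : ℕ} :
    i ∈ excpSet r π ↔ (1 ≤ i ∧ i ≤ n) ∧ i < pval π i ∧ r ≤ pval π i := by
  rw [excpSet, Finset.mem_filter, Finset.mem_Icc]

theorem winv_excWord {r : ℕ} :
    winv (excWord r π) = ∑ i ∈ excpSet r π,
      ((Finset.Ico 1 i).filter
        (fun a => ∀ y ∈ permRooks π, y.1 = a → pval π i ≤ y.2)).card := by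
  rw [excWord, winv_map_sort]
  refine Finset.sum_congr rfl fun i hi => ?_
  rw [mem_excpSet] at hi
  congr 1
  ext a
  simp only [Finset.mem_filter, mem_excpSet, Finset.mem_Ico]
  constructor
  · rintro ⟨⟨h1, -⟩, h2, h3⟩
    refine ⟨⟨h1.1, h2⟩, fun y hy hya => ?_⟩
    rw [← ((mem_permRooks π).1 hy).2, hya]
    exact h3.le
  · rintro ⟨⟨h1, h2⟩, h3⟩
    have h4 := h3 (a, pval π a) ((mem_permRooks π).2 ⟨⟨h1, by simp only; omega⟩, rfl⟩) rfl
    simp only at h4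
    have h5 : pval π i ≠ pval π a := fun h => h2.ne'
      (pval_injOn π hi.1.1 hi.1.2 h1 (by omega) h)
    omega

theorem winv_nexcWord {r : ℕ} :
    winv (nexcWord r π) = ∑ i ∈ Finset.Icc 1 n \ excpSet r π,
      ((Finset.Ico 1 (pval π i)).filter
        (fun b => ∀ y ∈ permRooks π, y.2 = b → i ≤ y.1)).card := by
  have h := winv_map_sort (Finset.Icc 1 n \ excpSet r π) (pval π)
  rw [nexcWord, h]
  have hswap : ∑ i ∈ Finset.Icc 1 n \ excpSet r π, ((Finset.Icc 1 n \ excpSet r π).filter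
        (fun a => a < i ∧ pval π i < pval π a)).card =
      ∑ i ∈ Finset.Icc 1 n \ excpSet r π, ((Finset.Icc 1 n \ excpSet r π).filter
        (fun j => i < j ∧ pval π j < pval π i)).card := by
    simp only [Finset.card_filter]
    exact Finset.sum_comm
  rw [hswap]
  refine Finset.sum_congr rfl fun i hi => ?_
  simp only [Finset.mem_sdiff, mem_excpSet, Finset.mem_Icc] at hi
  refine Finset.card_bij (fun j _ => pval π j) ?_ ?_ ?_
  · intro j hj
    simp only [Finset.mem_filter, Finset.mem_sdiff, Finset.mem_Icc, Finset.mem_Ico] at hj ⊢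
    refine ⟨⟨pval_pos π hj.1.1.1 hj.1.1.2, hj.2.2⟩, fun y hy h => ?_⟩
    obtain ⟨h1, h2⟩ := (mem_permRooks π).1 hy
    have := pval_injOn π h1.1 h1.2 hj.1.1.1 hj.1.1.2 (h2.trans h)
    omega
  · intro j hj k hk h
    simp only [Finset.mem_filter, Finset.mem_sdiff, Finset.mem_Icc] at hj hk
    exact pval_injOn π hj.1.1.1 hj.1.1.2 hk.1.1.1 hk.1.1.2 h
  · intro b hb
    rw [Finset.mem_filter, Finset.mem_Ico] at hb
    have hle := pval_le π i
    have hb' : b ∈ (Finset.Icc 1 n).image (pval π) := by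
      rw [image_pval, Finset.mem_Icc]
      omega
    obtain ⟨j, hj, rfl⟩ := Finset.mem_image.1 hb'
    rw [Finset.mem_Icc] at hj
    have h1 := hb.2 (j, pval π j) ((mem_permRooks π).2 ⟨hj, rfl⟩) rfl
    have h2 : i ≠ j := by
      rintro rfl
      exact lt_irrefl _ hb.1.2
    refine ⟨j, ?_, rfl⟩
    simp only [Finset.mem_filter, Finset.mem_sdiff, mem_excpSet, Finset.mem_Icc] at h1 ⊢
    omega

theorem rookWeight_permRooks {A : Type*} [CommRing A] {r : ℕ} {q t : A} :
    rookWeight r q t n (permRooks π) = t ^ excr r π * q ^ denr r π := by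
  rw [rookWeight, openRows_permRooks, Finset.prod_empty, mul_one, permRooks, Finset.prod_image
    (fun i _ j _ h => (Prod.mk.inj h).1), ← permRooks]
  have hsub : excpSet r π ⊆ Finset.Icc 1 n := Finset.filter_subset _ _
  rw [← Finset.prod_sdiff hsub, denr, winv_excWord, winv_nexcWord, excr_eq_card_filter]
  have h1 : ∏ i ∈ Finset.Icc 1 n \ excpSet r π, cellWeight r q t (permRooks π) (i, pval π i) =
      ∏ i ∈ Finset.Icc 1 n \ excpSet r π, q ^ ((Finset.Ico 1 (pval π i)).filter
        (fun b => ∀ y ∈ permRooks π, y.2 = b → i ≤ y.1)).card := by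
    refine Finset.prod_congr rfl fun i hi => ?_
    rw [cellWeight, if_neg]
    intro h
    rw [Finset.mem_sdiff, Finset.mem_Icc, mem_excpSet] at hi
    exact hi.2 ⟨hi.1, h⟩
  have h2 : ∏ i ∈ excpSet r π, cellWeight r q t (permRooks π) (i, pval π i) =
      ∏ i ∈ excpSet r π, ((if r ≤ i then t else 1) * q ^ i * q ^ ((Finset.Ico 1 i).filter
        (fun a => ∀ y ∈ permRooks π, y.1 = a → pval π i ≤ y.2)).card) := by
    refine Finset.prod_congr rfl fun i hi => ?_
    rw [mem_excpSet] at hi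
    rw [cellWeight, if_pos hi.2, rowWeight]
  rw [h1, h2, Finset.prod_mul_distrib, Finset.prod_mul_distrib, Finset.prod_pow_eq_pow_sum,
    Finset.prod_pow_eq_pow_sum, Finset.prod_pow_eq_pow_sum, ← Finset.prod_filter,
    Finset.prod_const, pow_add, pow_add]
  ring

theorem rookSum_square_eq_sum_perm {A : Type*} [CommRing A] (r : ℕ) (q t : A) (n : ℕ) :
    rookSum r q t n n 0 = ∑ π : Equiv.Perm (Fin n), t ^ excr r π * q ^ denr r π := by
  rw [rookSum, ← Finset.sum_filter]
  symm
  refine Finset.sum_bij (fun π _ => permRooks π) ?_ ?_ ?_ ?_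
  · intro π _
    rw [Finset.mem_filter]
    exact ⟨permRooks_mem_rooks π, by rw [openRows_permRooks, Finset.card_empty]⟩
  · exact fun π _ σ _ h => permRooks_injective h
  · intro R hR
    rw [Finset.mem_filter, Finset.card_eq_zero] at hR
    obtain ⟨π, h⟩ := exists_permRooks_eq hR.1 hR.2
    exact ⟨π, Finset.mem_univ _, h⟩
  · exact fun π _ => (rookWeight_permRooks π).symm

end PermRooks

theorem rMajSum_zero {A : Type*} [CommRing A] (r : ℕ) (q t : A) : rMajSum r q t 0 = 1 := by
  simp [rMajSum, rdes, rmaj, rDesSet, rInvSet]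

theorem rMajSum_base {A : Type*} [CommRing A] (ρ : ℕ) (q t : A) {m : ℕ} (hm : m ≤ ρ + 1) :
    rMajSum (ρ + 1) q t m = ∏ i ∈ Finset.range m, qNat q (i + 1) := by
  induction m with
  | zero => rw [rMajSum_zero, Finset.prod_range_zero]
  | succ m ih =>
    rw [rMajSum_of_lt (by omega) q t (by omega), ih (by omega), Finset.prod_range_succ, mul_comm]

theorem rMajSum_eq_rookSum {A : Type*} [CommRing A] [IsDomain A] {q : A} (hq : q ≠ 1)
    (ρ m : ℕ) (t : A) :
    rMajSum (ρ + 1) q t (ρ + m) = rookSum (ρ + 1) q t (ρ + m) (ρ + m) 0 := by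
  induction m generalizing t with
  | zero => rw [Nat.add_zero ρ, rookSum_square_zero, rMajSum_base ρ q t (Nat.le_succ ρ)]
  | succ m ih =>
    have hq' : 1 - q ≠ 0 := sub_ne_zero.2 hq.symm
    refine mul_left_cancel₀ hq' ?_
    rw [← Nat.add_assoc, rMajSum_recursion (by omega) q t (by omega), rookSum_recursion, ih, ih]

theorem excpSet_of_lt {n r : ℕ} (h : n < r) (π : Equiv.Perm (Fin n)) : excpSet r π = ∅ := by
  refine Finset.filter_eq_empty_iff.2 fun i _ => ?_
  have := pval_le π i
  omega

theorem excr_of_lt {n r : ℕ} (h : n < r) (π : Equiv.Perm (Fin n)) : excr r π = 0 := by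
  rw [excr_eq_card_filter, excpSet_of_lt h, Finset.filter_empty, Finset.card_empty]

theorem denr_of_lt {n r : ℕ} (h : n < r) (π : Equiv.Perm (Fin n)) :
    denr r π = denr (n + 1) π := by
  simp only [denr, excWord, nexcWord, excpSet_of_lt h, excpSet_of_lt (Nat.lt_succ_self n)]

theorem rMajSum_eq_sum_denr {A : Type*} [CommRing A] [IsDomain A] {q : A} (hq : q ≠ 1)
    {n r : ℕ} (hr : 1 ≤ r) (t : A) :
    rMajSum r q t n = ∑ π : Equiv.Perm (Fin n), t ^ excr r π * q ^ denr r π := by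
  rcases lt_or_ge n r with h | h
  · obtain ⟨ρ, rfl⟩ : ∃ ρ, r = ρ + 1 := ⟨r - 1, by omega⟩
    have h1 : ∑ π : Equiv.Perm (Fin n), t ^ excr (ρ + 1) π * q ^ denr (ρ + 1) π =
        rookSum (n + 1) q t n n 0 := by
      rw [rookSum_square_eq_sum_perm]
      refine Finset.sum_congr rfl fun π _ => ?_
      rw [excr_of_lt h, excr_of_lt (Nat.lt_succ_self n), denr_of_lt h]
    rw [h1, rookSum_square_zero, rMajSum_base ρ q t h.le]
  · obtain ⟨ρ, rfl⟩ : ∃ ρ, r = ρ + 1 := ⟨r - 1, by omega⟩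
    obtain ⟨m, rfl⟩ : ∃ m, n = ρ + m := ⟨n - ρ, by omega⟩
    rw [rMajSum_eq_rookSum hq, rookSum_square_eq_sum_perm]

theorem coeff_coeff_sum_X_pow {ι : Type*} (s : Finset ι) (f g : ι → ℕ) (k m : ℕ) :
    ((∑ i ∈ s, (Polynomial.X : Polynomial (Polynomial ℤ)) ^ f i *
      Polynomial.C Polynomial.X ^ g i).coeff k).coeff m =
      ((s.filter (fun i => f i = k ∧ g i = m)).card : ℤ) := by
  rw [Polynomial.finsetSum_coeff, Polynomial.finsetSum_coeff, Finset.card_filter, Nat.cast_sum]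
  refine Finset.sum_congr rfl fun i _ => ?_
  rw [← Polynomial.C_pow, Polynomial.coeff_mul_C, Polynomial.coeff_X_pow]
  by_cases hk : f i = k
  · rw [if_pos hk.symm, one_mul, Polynomial.coeff_X_pow]
    simp only [hk, true_and, eq_comm (a := m)]
    split_ifs <;> simp
  · rw [if_neg (Ne.symm hk), zero_mul, Polynomial.coeff_zero]
    simp [hk]

/-- For all n ≥ 1 and r ≥ 1, the pair (exc_r, den_r) is
r-Euler-Mahonian over S_n: for all k, m, the number of π ∈ S_n with
rdes(π) = k and rmaj(π) = m equals the number of π ∈ S_n with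
exc_r(π) = k and den_r(π) = m. -/
theorem rEulerMahonian_excr_denr (n r : ℕ) (hn : 1 ≤ n) (hr : 1 ≤ r) (k m : ℕ) :
    (Finset.univ.filter
      (fun π : Equiv.Perm (Fin n) => rdes r π = k ∧ rmaj r π = m)).card =
    (Finset.univ.filter
      (fun π : Equiv.Perm (Fin n) => excr r π = k ∧ denr r π = m)).card := by
  have hq : (Polynomial.C Polynomial.X : Polynomial (Polynomial ℤ)) ≠ 1 := by
    rw [Ne, ← Polynomial.C_1, Polynomial.C_inj]
    exact Polynomial.X_ne_C 1
  have h := rMajSum_eq_sum_denr hq hr (n := n) (Polynomial.X : Polynomial (Polynomial ℤ))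
  have h' := congrArg (fun P => (P.coeff k).coeff m) h
  simp only [rMajSum, coeff_coeff_sum_X_pow] at h'
  exact_mod_cast h'
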